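/- arXiv:2506.16271 — 2 statements merged into one kernel-verified Lean document; each statement's English description precedes it below -/
import Mathlib

section
/- Let q be a prime power, I an index set, α, β ∈ I, and b, c ∈ U. Let N(α,β,b,c) be the number of pairs (u,v) ∈ U × U with u = c v and α^{q+1} b = β² u v. If q is even, then N(α,β,b,c) = 1 when α = β and N(α,β,b,c) = 0 when α ≠ β. If q is odd and α ≠ β, then N(α,β,b,c) = 0. If q is odd and α = β, then N(α,β,b,c) = 2 if either α^{q+1} is a square in F_q and (cb)^{(q+1)/2} = 1, or α^{q+1} is a nonsquare in F_q and (cb)^{(q+1)/2} = −1; otherwise N(α,β,b,c) = 0. -/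
noncomputable section

variable (q : ℕ) (F : Type) [Field F]

/-- `U = { u : u^{q+1} = 1 }`. -/
def Uset : Set F := {u : F | u ^ (q + 1) = 1}

/-- The subfield `F_q` of `F_{q²}`, as a set. -/
def FqSet : Set F := {x : F | x ^ q = x}

/-- The norm image `N = { α^{q+1} : α ∈ I }`. -/
def normIm (I : Set F) : Set F := (fun α : F => α ^ (q + 1)) '' I

/-- `I` is an index set. -/
def IsIndexSet (I : Set F) : Prop :=
  (0 : F) ∉ I ∧
  Set.InjOn (fun α : F => α ^ (q + 1)) I ∧
  (∀ a ∈ normIm q F I, a ∈ FqSet q F) ∧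
  (1 : F) ∉ normIm q F I ∧
  normIm q F I ∪ Inv.inv '' normIm q F I ∪ {1} = FqSet q F \ {0} ∧
  (Even q → normIm q F I ∩ Inv.inv '' normIm q F I = ∅) ∧
  (Odd q → normIm q F I ∩ Inv.inv '' normIm q F I = {-1} ∧
    normIm q F I ∩ Neg.neg '' normIm q F I = ∅)

/-- `a` is a square of an element of the subfield `F_q`. -/
def IsSqFq (a : F) : Prop := ∃ x : F, x ^ q = x ∧ x ^ 2 = a

/-- `G` is a good set (relative to the index set `I`). -/
def IsGoodSet (I : Set F) (G : Finset (F × F × F)) : Prop :=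
  G.card = q + 1 ∧
  (∀ t ∈ G, t.1 ∈ I ∧ t.2.1 ∈ Uset q F ∧ t.2.2 ∈ Uset q F) ∧
  ∀ t ∈ G, ∀ t' ∈ G, t ≠ t' →
    t.2.1 * t'.2.2 - t'.2.1 * t.2.2 ≠ 0 ∧
    t.1 * t.2.1 * (t'.1 * t'.2.2) ^ q - (t.1 * t.2.2) ^ q * (t'.1 * t'.2.1) ≠ 0

end

/-- The set of pairs `(u, v) ∈ U × U` with `u = c v` and `α^{q+1} b = β² u v`. -/
def NCount (q : ℕ) (F : Type) [Field F] (α β b c : F) : Set (F × F) :=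
  {p : F × F | p.1 ∈ Uset q F ∧ p.2 ∈ Uset q F ∧ p.1 = c * p.2 ∧
    α ^ (q + 1) * b = β ^ 2 * p.1 * p.2}

section Counting

variable {q : ℕ} {F : Type} [Field F]

theorem ne_zero_of_mem_Uset {u : F} (hu : u ∈ Uset q F) : u ≠ 0 := by
  rintro rfl
  simp [Uset] at hu

/-- For `α = β`, the pairs are governed by the equation `α² c v² = α^{q+1} b`. -/
theorem mem_NCount_self_iff {α b c : F} (hc : c ∈ Uset q F) (p : F × F) :
    p ∈ NCount q F α α b c ↔
      p.1 = c * p.2 ∧ p.2 ∈ Uset q F ∧ α ^ (q + 1) * b = α ^ 2 * c * p.2 ^ 2 := by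
  obtain ⟨u, v⟩ := p
  simp only [NCount, Set.mem_ofPred_eq]
  constructor
  · rintro ⟨-, hv, rfl, h⟩
    exact ⟨rfl, hv, by rw [h]; ring⟩
  · rintro ⟨rfl, hv, h⟩
    refine ⟨?_, hv, rfl, by rw [h]; ring⟩
    simp only [Uset, Set.mem_ofPred_eq] at hc hv ⊢
    rw [mul_pow, hc, hv, one_mul]

/-- For odd `q = 2m + 1`, a root `v` of `α² c v² = α^{q+1} b` has norm
`(α^{q+1})^m (c b)^{m+1}`. -/
theorem norm_root_eq {m : ℕ} {α b c v : F} (hα : α ≠ 0)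
    (hc : c ^ (2 * m + 1 + 1) = 1) (h : α ^ (2 * m + 1 + 1) * b = α ^ 2 * c * v ^ 2) :
    v ^ (2 * m + 1 + 1) = (α ^ (2 * m + 1 + 1)) ^ m * (c * b) ^ (m + 1) := by
  have h1 : α ^ (2 * m) * (c * b) = c ^ 2 * v ^ 2 := by
    apply mul_left_cancel₀ (pow_ne_zero 2 hα)
    linear_combination c * h
  have h2 := congrArg (· ^ (m + 1)) h1
  simp only [mul_pow _ _ (m + 1), ← pow_mul] at h2
  rw [show 2 * (m + 1) = 2 * m + 1 + 1 by ring, hc, one_mul] at h2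
  rw [← h2, ← pow_mul, mul_pow]
  congr 2
  ring

/-- Euler's criterion in `F_q` for norms from `F_{q²}`. -/
theorem isSqFq_norm_iff {m : ℕ} {α : F} (hα : α ≠ 0) :
    IsSqFq (2 * m + 1) F (α ^ (2 * m + 1 + 1)) ↔ (α ^ (2 * m + 1 + 1)) ^ m = 1 := by
  have hsq : α ^ (2 * m + 1 + 1) = (α ^ (m + 1)) ^ 2 := by rw [← pow_mul]; congr 1; ring
  constructor
  · rintro ⟨x, hx, hxA⟩
    have hx0 : x ≠ 0 := by
      rintro rfl
      exact pow_ne_zero _ hα (hxA.symm.trans (zero_pow two_ne_zero))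
    rw [← hxA, ← pow_mul]
    apply mul_right_cancel₀ hx0
    rw [← pow_succ, hx, one_mul]
  · intro h
    refine ⟨α ^ (m + 1), ?_, hsq.symm⟩
    rw [pow_succ, pow_mul, ← hsq, h, one_mul]

theorem NCount_self_eq_empty_of_odd {m : ℕ} {α b c : F}
    (hα : α ≠ 0) (hc : c ∈ Uset (2 * m + 1) F)
    (h : (α ^ (2 * m + 1 + 1)) ^ m * (c * b) ^ (m + 1) ≠ 1) :
    NCount (2 * m + 1) F α α b c = ∅ := by
  refine Set.eq_empty_of_forall_notMem fun p hp => h ?_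
  obtain ⟨-, hv, h3⟩ := (mem_NCount_self_iff hc p).mp hp
  exact (norm_root_eq hα hc h3).symm.trans hv

variable [Fintype F]

theorem pow_sub_one_norm (hF : Fintype.card F = q ^ 2) {α : F} (hα : α ≠ 0) :
    (α ^ (q + 1)) ^ (q - 1) = 1 := by
  have h := FiniteField.pow_card_sub_one_eq_one α hα
  rw [hF] at h
  rw [← pow_mul, ← h]
  congr 1
  simpa using (Nat.sq_sub_sq q 1).symm

/-- If there is any pair, the norms of `α` and `β` have the same square. -/
theorem sq_norm_eq_of_mem_NCount (hq : 0 < q) (hF : Fintype.card F = q ^ 2) {α β b c : F}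
    (hα : α ≠ 0) (hb : b ∈ Uset q F) {p : F × F} (hp : p ∈ NCount q F α β b c) :
    (α ^ (q + 1)) ^ 2 = (β ^ (q + 1)) ^ 2 := by
  obtain ⟨hu, hv, -, h⟩ := hp
  simp only [Uset, Set.mem_ofPred_eq] at hu hv hb
  have h' := congrArg (· ^ (q + 1)) h
  simp only [mul_pow, hu, hv, hb, mul_one] at h'
  have hs : (α ^ (q + 1)) ^ (q + 1) = (α ^ (q + 1)) ^ 2 := by
    rw [show q + 1 = (q - 1) + 2 by omega, pow_add _ (q - 1) 2,
      show q - 1 + 2 = q + 1 by omega, pow_sub_one_norm hF hα, one_mul]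
  rw [hs] at h'
  rw [h', ← pow_mul, ← pow_mul, mul_comm]

theorem ringChar_eq_two_iff_even (hF : Fintype.card F = q ^ 2) : ringChar F = 2 ↔ Even q := by
  rw [FiniteField.even_card_iff_char_two, hF, ← Nat.even_iff, Nat.even_pow' two_ne_zero]

theorem eq_of_mem_NCount (hq : 0 < q) (hF : Fintype.card F = q ^ 2) {I : Set F}
    (hI : IsIndexSet q F I) {α β b c : F} (hα : α ∈ I) (hβ : β ∈ I) (hb : b ∈ Uset q F)
    {p : F × F} (hp : p ∈ NCount q F α β b c) : α = β := by
  obtain ⟨h0, hinj, -, -, -, -, hodd⟩ := hI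
  have hα0 : α ≠ 0 := fun h => h0 (h ▸ hα)
  apply hinj hα hβ
  rcases sq_eq_sq_iff_eq_or_eq_neg.mp (sq_norm_eq_of_mem_NCount hq hF hα0 hb hp) with h | h
  · exact h
  rcases Nat.even_or_odd q with he | ho
  · have : CharP F 2 := (ringChar_eq_two_iff_even hF).mpr he ▸ ringChar.charP F
    simpa [CharTwo.neg_eq] using h
  · have hmem : α ^ (q + 1) ∈ normIm q F I ∩ Neg.neg '' normIm q F I :=
      ⟨⟨α, hα, rfl⟩, β ^ (q + 1), ⟨β, hβ, rfl⟩, h.symm⟩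
    rw [(hodd ho).2] at hmem
    exact hmem.elim

theorem ncard_NCount_self_of_even (hF : Fintype.card F = q ^ 2) (he : Even q) {α b c : F}
    (hα : α ≠ 0) (hb : b ∈ Uset q F) (hc : c ∈ Uset q F) :
    (NCount q F α α b c).ncard = 1 := by
  have hchar := (ringChar_eq_two_iff_even hF).mpr he
  have : CharP F 2 := hchar ▸ ringChar.charP F
  have hc0 := ne_zero_of_mem_Uset hc
  obtain ⟨v, hv⟩ := FiniteField.isSquare_of_char_two hchar (α ^ (q + 1) * b / (α ^ 2 * c))
  have hv2 : α ^ (q + 1) * b = α ^ 2 * c * v ^ 2 := by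
    rw [sq v, ← hv]
    field_simp
  have hvU : v ∈ Uset q F := by
    simp only [Uset, Set.mem_ofPred_eq] at hb hc ⊢
    have hA := congrArg (· ^ (q + 1)) hv2
    simp only [mul_pow, hb, hc, mul_one] at hA
    have hq : 0 < q := Nat.pos_of_ne_zero fun h => by simp [h] at hF
    have hs : (α ^ (q + 1)) ^ (q + 1) = (α ^ 2) ^ (q + 1) := by
      rw [← one_mul ((α ^ 2) ^ (q + 1)), ← pow_sub_one_norm hF hα]
      rw [← pow_mul, ← pow_mul, ← pow_mul, ← pow_add]
      congr 1
      obtain ⟨k, rfl⟩ : ∃ k, q = k + 1 := ⟨q - 1, by omega⟩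
      simp only [Nat.add_sub_cancel]
      ring
    rw [hs] at hA
    have h1 : (v ^ (q + 1)) ^ 2 = 1 := by
      rw [← pow_mul, mul_comm, pow_mul]
      exact (mul_eq_left₀ (pow_ne_zero _ (pow_ne_zero _ hα))).mp hA.symm
    rcases sq_eq_one_iff.mp h1 with h | h
    · exact h
    · rw [h, CharTwo.neg_eq]
  rw [Set.ncard_eq_one]
  refine ⟨(c * v, v), Set.ext fun p => ?_⟩
  rw [mem_NCount_self_iff hc, Set.mem_singleton_iff]
  constructor
  · rintro ⟨h1, -, h3⟩
    have h2 : p.2 ^ 2 = v ^ 2 :=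
      mul_left_cancel₀ (mul_ne_zero (pow_ne_zero 2 hα) hc0) (h3.symm.trans hv2)
    have h4 : p.2 = v := by
      rcases sq_eq_sq_iff_eq_or_eq_neg.mp h2 with h | h
      · exact h
      · rw [h, CharTwo.neg_eq]
    exact Prod.ext (by rw [h1, h4]) h4
  · rintro rfl
    exact ⟨rfl, hvU, hv2⟩

theorem norm_pow_half_eq_or {m : ℕ} (hF : Fintype.card F = (2 * m + 1) ^ 2) {α : F}
    (hα : α ≠ 0) : (α ^ (2 * m + 1 + 1)) ^ m = 1 ∨ (α ^ (2 * m + 1 + 1)) ^ m = -1 := by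
  rw [← sq_eq_one_iff, ← pow_mul, mul_comm m 2]
  exact pow_sub_one_norm hF hα

theorem squareCondition_iff {m : ℕ} (hF : Fintype.card F = (2 * m + 1) ^ 2) {α b c : F}
    (hα : α ≠ 0) :
    ((IsSqFq (2 * m + 1) F (α ^ (2 * m + 1 + 1)) ∧ (c * b) ^ ((2 * m + 1 + 1) / 2) = 1) ∨
      (¬ IsSqFq (2 * m + 1) F (α ^ (2 * m + 1 + 1)) ∧
        (c * b) ^ ((2 * m + 1 + 1) / 2) = -1)) ↔
      (α ^ (2 * m + 1 + 1)) ^ m * (c * b) ^ (m + 1) = 1 := by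
  have hchar : ringChar F ≠ 2 := fun h => by
    have := (ringChar_eq_two_iff_even hF).mp h
    exact Nat.not_even_two_mul_add_one m this
  rw [isSqFq_norm_iff hα, show (2 * m + 1 + 1) / 2 = m + 1 by omega]
  rcases norm_pow_half_eq_or hF hα with h | h
  · simp [h]
  · simp [h, Ring.neg_one_ne_one_of_char_ne_two hchar, neg_eq_iff_eq_neg]

theorem ncard_NCount_self_of_odd {m : ℕ} (hF : Fintype.card F = (2 * m + 1) ^ 2) {α b c : F}
    (hα : α ≠ 0) (hb : b ∈ Uset (2 * m + 1) F) (hc : c ∈ Uset (2 * m + 1) F)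
    (h : (α ^ (2 * m + 1 + 1)) ^ m * (c * b) ^ (m + 1) = 1) :
    (NCount (2 * m + 1) F α α b c).ncard = 2 := by
  have hchar : ringChar F ≠ 2 := fun h => by
    have := (ringChar_eq_two_iff_even hF).mp h
    exact Nat.not_even_two_mul_add_one m this
  have hb0 := ne_zero_of_mem_Uset hb
  have hc0 := ne_zero_of_mem_Uset hc
  have hcb : IsSquare (c * b) := by
    rw [FiniteField.isSquare_iff hchar (mul_ne_zero hc0 hb0), hF,
      show (2 * m + 1) ^ 2 / 2 = (2 * m + 1 + 1) * m by
        rw [show (2 * m + 1) ^ 2 = 2 * ((2 * m + 1 + 1) * m) + 1 by ring]; omega, pow_mul]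
    simp only [Uset, Set.mem_ofPred_eq] at hb hc
    rw [mul_pow, hb, hc, one_mul, one_pow]
  obtain ⟨r, hr⟩ := hcb
  obtain ⟨v, hv⟩ : ∃ v, v = α ^ m * r / c := ⟨_, rfl⟩
  have hv2 : α ^ (2 * m + 1 + 1) * b = α ^ 2 * c * v ^ 2 := by
    apply mul_left_cancel₀ hc0
    rw [hv, div_pow, mul_pow, sq r, ← hr]
    field_simp
    ring
  have hvU : v ∈ Uset (2 * m + 1) F := (norm_root_eq hα hc hv2).trans h
  have hv0 := ne_zero_of_mem_Uset hvU
  have hnvU : -v ∈ Uset (2 * m + 1) F :=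
    (norm_root_eq hα hc (by rw [neg_sq, hv2])).trans h
  rw [Set.ncard_eq_two]
  refine ⟨(c * v, v), (c * -v, -v), ?_, Set.ext fun p => ?_⟩
  · intro h
    exact hv0 (Ring.eq_self_iff_eq_zero_of_char_ne_two hchar |>.mp (Prod.ext_iff.mp h).2.symm)
  rw [mem_NCount_self_iff hc, Set.mem_insert_iff, Set.mem_singleton_iff]
  constructor
  · rintro ⟨h1, -, h3⟩
    have h2 : p.2 ^ 2 = v ^ 2 :=
      mul_left_cancel₀ (mul_ne_zero (pow_ne_zero 2 hα) hc0) (h3.symm.trans hv2)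
    rcases sq_eq_sq_iff_eq_or_eq_neg.mp h2 with h4 | h4
    · exact Or.inl (Prod.ext (by rw [h1, h4]) h4)
    · exact Or.inr (Prod.ext (by rw [h1, h4]) h4)
  · rintro (rfl | rfl)
    · exact ⟨rfl, hvU, hv2⟩
    · exact ⟨rfl, hnvU, by rw [neg_sq, hv2]⟩

end Counting

/-- Counting the pairs `(u,v) ∈ U × U` with `u = c v` and `α^{q+1} b = β² u v`. -/
theorem statement13 (q : ℕ) (hq : IsPrimePow q) (F : Type) [Field F] [Fintype F]
    (hF : Fintype.card F = q ^ 2) (I : Set F) (hI : IsIndexSet q F I)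
    (α β : F) (hα : α ∈ I) (hβ : β ∈ I)
    (b c : F) (hb : b ∈ Uset q F) (hc : c ∈ Uset q F) :
    (Even q →
      (α = β → (NCount q F α β b c).ncard = 1) ∧
      (α ≠ β → (NCount q F α β b c).ncard = 0)) ∧
    (Odd q → α ≠ β → (NCount q F α β b c).ncard = 0) ∧
    (Odd q → α = β →
      (((IsSqFq q F (α ^ (q + 1)) ∧ (c * b) ^ ((q + 1) / 2) = 1) ∨
          (¬ IsSqFq q F (α ^ (q + 1)) ∧ (c * b) ^ ((q + 1) / 2) = -1)) →
        (NCount q F α β b c).ncard = 2) ∧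
      (¬ ((IsSqFq q F (α ^ (q + 1)) ∧ (c * b) ^ ((q + 1) / 2) = 1) ∨
          (¬ IsSqFq q F (α ^ (q + 1)) ∧ (c * b) ^ ((q + 1) / 2) = -1)) →
        (NCount q F α β b c).ncard = 0)) := by
  have hq0 := hq.pos
  have hα0 : α ≠ 0 := fun h => hI.1 (h ▸ hα)
  have hne : α ≠ β → (NCount q F α β b c).ncard = 0 := fun h => by
    rw [Set.eq_empty_of_forall_notMem fun p hp => h (eq_of_mem_NCount hq0 hF hI hα hβ hb hp),
      Set.ncard_empty]
  refine ⟨fun he => ⟨?_, hne⟩, fun _ => hne, ?_⟩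
  · rintro rfl
    exact ncard_NCount_self_of_even hF he hα0 hb hc
  · rintro ⟨m, rfl⟩ rfl
    rw [squareCondition_iff hF hα0]
    refine ⟨ncard_NCount_self_of_odd hF hα0 hb hc, fun h => ?_⟩
    rw [NCount_self_eq_empty_of_odd hα0 hc h, Set.ncard_empty]
end

section
/- Let q be an even prime power and I an index set. Then the number of good sets equals |I|^{q+1} · (q+1)! = ((q−2)/2)^{q+1} · (q+1)!. -/
open scoped Nat in
/-- Under an equivalence `T ≃ A × B × B`, the sets of `|B|` elements on which both `B`-coordinates
are injective are the labelled permutations of `B`. -/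
theorem ncard_labelled_perms {T A B : Type*} [Finite A] [Finite B] (e : T ≃ A × B × B) :
    {G : Finset T | G.card = Nat.card B ∧ ∀ t ∈ G, ∀ t' ∈ G, t ≠ t' →
      (e t).2.1 ≠ (e t').2.1 ∧ (e t).2.2 ≠ (e t').2.2}.ncard
      = Nat.card A ^ Nat.card B * (Nat.card B)! := by
  classical
  have := Fintype.ofFinite A
  have := Fintype.ofFinite B
  let c (x : (B → A) × Equiv.Perm B) : B ↪ T :=
    ⟨fun b => e.symm (x.1 b, b, x.2 b), fun b b' h => by simp_all⟩
  have hec (x b) : e (c x b) = (x.1 b, b, x.2 b) := e.apply_symm_apply _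
  let Ψ (x : (B → A) × Equiv.Perm B) : Finset T := Finset.univ.map (c x)
  have hΨ : Function.Injective Ψ := by
    intro x y h
    have key : ∀ b, x.1 b = y.1 b ∧ x.2 b = y.2 b := by
      intro b
      have hb : c x b ∈ Ψ y := h ▸ Finset.mem_map_of_mem _ (Finset.mem_univ b)
      simp only [Ψ, Finset.mem_map, Finset.mem_univ, true_and] at hb
      obtain ⟨b', hb'⟩ := hb
      have := e.symm.injective hb'
      simp only [Prod.mk.injEq] at this
      obtain ⟨h1, rfl, h2⟩ := this
      exact ⟨h1.symm, h2.symm⟩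
    exact Prod.ext (funext fun b => (key b).1) (Equiv.ext fun b => (key b).2)
  have hrange : {G : Finset T | G.card = Nat.card B ∧ ∀ t ∈ G, ∀ t' ∈ G, t ≠ t' →
      (e t).2.1 ≠ (e t').2.1 ∧ (e t).2.2 ≠ (e t').2.2} = Set.range Ψ := by
    ext G
    constructor
    · rintro ⟨hc, hG⟩
      have hcard : Fintype.card G = Fintype.card B := by
        rw [Fintype.card_coe, hc, Nat.card_eq_fintype_card]
      let p := Equiv.ofBijective (fun t : G => (e t).2.1)
        ((Fintype.bijective_iff_injective_and_card _).2 ⟨fun t t' h => by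
          by_contra hne
          exact (hG t t.2 t' t'.2 fun h' => hne (Subtype.ext h')).1 h, hcard⟩)
      let r := Equiv.ofBijective (fun t : G => (e t).2.2)
        ((Fintype.bijective_iff_injective_and_card _).2 ⟨fun t t' h => by
          by_contra hne
          exact (hG t t.2 t' t'.2 fun h' => hne (Subtype.ext h')).2 h, hcard⟩)
      refine ⟨(fun b => (e (p.symm b)).1, p.symm.trans r), ?_⟩
      refine Finset.eq_of_subset_of_card_le (fun t ht => ?_) ?_
      · simp only [Ψ, Finset.mem_map, Finset.mem_univ, true_and] at ht
        obtain ⟨b, rfl⟩ := ht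
        have hb : (e (p.symm b)).2.1 = b := p.apply_symm_apply b
        have : c (fun b => (e (p.symm b)).1, p.symm.trans r) b = (p.symm b : T) := by
          apply e.injective
          rw [hec]
          exact Prod.ext rfl (Prod.ext hb.symm rfl)
        rw [this]
        exact (p.symm b).2
      · simp [Ψ, hc]
    · rintro ⟨x, rfl⟩
      refine ⟨by simp [Ψ], ?_⟩
      simp only [Ψ, Finset.mem_map, Finset.mem_univ, true_and]
      rintro _ ⟨b, rfl⟩ _ ⟨b', rfl⟩ hne
      have hb : b ≠ b' := fun h => hne (h ▸ rfl)
      simpa [hec] using hb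
  rw [hrange, Set.ncard_range_of_injective hΨ, Nat.card_prod, Nat.card_fun, Nat.card_perm]

/-- In a finite commutative group of odd order, `(a, u, v) ↦ (a, u / v, κ a * u * v)` is
bijective. -/
theorem bijective_div_mul_of_odd_card {A B : Type*} [Finite A] [CommGroup B] [Finite B]
    (hB : Odd (Nat.card B)) (κ : A → B) :
    Function.Bijective
      (fun t : A × B × B => (t.1, t.2.1 / t.2.2, κ t.1 * t.2.1 * t.2.2)) := by
  refine Function.Injective.bijective_of_finite ?_
  rintro ⟨a, u, v⟩ ⟨a', u', v'⟩ h
  simp only [Prod.mk.injEq] at h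
  obtain ⟨rfl, h1, h2⟩ := h
  have h3 : u * v = u' * v' := by simpa [mul_assoc] using h2
  have h4 : u ^ 2 = u' ^ 2 := by
    calc u ^ 2 = u / v * (u * v) := by rw [mul_comm u v, ← mul_assoc, div_mul_cancel, sq]
      _ = u' / v' * (u' * v') := by rw [h1, h3]
      _ = u' ^ 2 := by rw [mul_comm u' v', ← mul_assoc, div_mul_cancel, sq]
  have h5 : u = u' :=
    (powCoprime (G := B) (n := 2) (Nat.coprime_two_right.2 hB)).injective h4
  subst h5
  simpa using h3

theorem natCard_rootsOfUnity_of_dvd {F : Type*} [Field F] [Finite F] {n : ℕ}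
    (h : n ∣ Nat.card F - 1) : Nat.card (rootsOfUnity n F) = n := by
  rw [← Nat.card_units] at h
  exact (IsCyclic.card_powMonoidHom_ker (G := Fˣ) n).trans (Nat.gcd_eq_right h)

theorem ncard_FqSet_diff_zero {q : ℕ} (hq : 2 ≤ q) {F : Type} [Field F] [Fintype F]
    (hF : Fintype.card F = q ^ 2) : (FqSet q F \ {0}).ncard = q - 1 := by
  have hset : FqSet q F \ {0} = Units.val '' (rootsOfUnity (q - 1) F : Set Fˣ) := by
    ext x
    have hpow : x ^ q = x ^ (q - 1) * x := by rw [← pow_succ, Nat.sub_add_cancel (by omega)]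
    simp only [FqSet, Set.mem_sdiff, Set.mem_ofPred_eq, Set.mem_singleton_iff, Set.mem_image,
      SetLike.mem_coe, mem_rootsOfUnity, hpow]
    constructor
    · rintro ⟨hx, h0⟩
      exact ⟨Units.mk0 x h0, Units.ext (by simpa [h0] using hx), rfl⟩
    · rintro ⟨y, hy, rfl⟩
      refine ⟨?_, y.ne_zero⟩
      rw [← Units.val_pow_eq_pow_val, hy, Units.val_one, one_mul]
  rw [hset, Set.ncard_image_of_injective _ Units.val_injective]
  refine natCard_rootsOfUnity_of_dvd ?_
  rw [Nat.card_eq_fintype_card, hF]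
  exact ⟨q + 1, by rw [mul_comm, ← Nat.sq_sub_sq, one_pow]⟩

theorem IsIndexSet.ncard_eq {q : ℕ} (hq : 2 ≤ q) (hqe : Even q) {F : Type} [Field F] [Fintype F]
    (hF : Fintype.card F = q ^ 2) {I : Set F} (hI : IsIndexSet q F I) :
    I.ncard = (q - 2) / 2 := by
  obtain ⟨-, hinj, -, h1, hU, hdisj, -⟩ := hI
  have hN : (normIm q F I).ncard = I.ncard := hinj.ncard_image
  have hNinv : (Inv.inv '' normIm q F I).ncard = I.ncard := by
    rw [Set.ncard_image_of_injective _ inv_injective, hN]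
  have hcard := congrArg Set.ncard hU
  rw [ncard_FqSet_diff_zero hq hF, Set.union_singleton, Set.ncard_insert_of_notMem,
    Set.ncard_union_eq (Set.disjoint_iff_inter_eq_empty.2 (hdisj hqe)), hN, hNinv] at hcard
  · omega
  · simpa using h1

/-- The map `α ↦ α^{1-q}` from nonzero elements of `F_{q²}` to `U`. -/
theorem exists_mul_pow_eq {q : ℕ} {F : Type} [Field F] [Fintype F]
    (hF : Fintype.card F = q ^ 2) {α : F} (hα : α ≠ 0) :
    ∃ k : rootsOfUnity (q + 1) F, ((k : Fˣ) : F) * α ^ q = α := by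
  refine ⟨⟨Units.mk0 α hα / Units.mk0 α hα ^ q, ?_⟩, ?_⟩
  · rw [mem_rootsOfUnity, div_pow, div_eq_one, ← pow_mul]
    ext
    have h := FiniteField.pow_card α
    rw [hF] at h
    simp only [Units.val_pow_eq_pow_val, Units.val_mk0]
    calc α ^ (q + 1) = α ^ q * α ^ (q ^ 2) := by rw [h, pow_succ]
      _ = α ^ (q * (q + 1)) := by rw [← pow_add]; congr 1; ring
  · simp only [Units.val_div_eq_div_val, Units.val_pow_eq_pow_val, Units.val_mk0]
    exact div_mul_cancel₀ _ (pow_ne_zero _ hα)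

theorem coe_rootsOfUnity_pow {n : ℕ} {M : Type*} [CommMonoid M] (w : rootsOfUnity n M) :
    ((w : Mˣ) : M) ^ n = 1 :=
  congrArg Units.val ((mem_rootsOfUnity _ _).1 w.2)

theorem mul_pow_sub_ne_zero_iff {q : ℕ} {F : Type*} [Field F] {α α' : F} (hα : α ≠ 0)
    (hα' : α' ≠ 0) {k k' u v u' v' : rootsOfUnity (q + 1) F}
    (hk : ((k : Fˣ) : F) * α ^ q = α) (hk' : ((k' : Fˣ) : F) * α' ^ q = α') :
    α * (u : Fˣ) * (α' * (v' : Fˣ)) ^ q - (α * (v : Fˣ)) ^ q * (α' * (u' : Fˣ)) ≠ 0 ↔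
      k * u * v ≠ k' * u' * v' := by
  have hroot (w : rootsOfUnity (q + 1) F) : ((w : Fˣ) : F) ^ q * (w : Fˣ) = 1 := by
    rw [← pow_succ, coe_rootsOfUnity_pow]
  have hz : (α ^ q * α' ^ q * ((v : Fˣ) : F) ^ q * ((v' : Fˣ) : F) ^ q) ≠ 0 := by simp [hα, hα']
  have hsub : α * (u : Fˣ) * (α' * (v' : Fˣ)) ^ q - (α * (v : Fˣ)) ^ q * (α' * (u' : Fˣ))
      = (α ^ q * α' ^ q * ((v : Fˣ) : F) ^ q * ((v' : Fˣ) : F) ^ q) *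
        ((k : Fˣ) * (u : Fˣ) * (v : Fˣ) - (k' : Fˣ) * (u' : Fˣ) * (v' : Fˣ)) := by
    rw [mul_pow, mul_pow]
    linear_combination (-((u : Fˣ) : F) * α' ^ q * ((v' : Fˣ) : F) ^ q) * hk
      + (((u' : Fˣ) : F) * α ^ q * ((v : Fˣ) : F) ^ q) * hk'
      - (α ^ q * α' ^ q * ((v' : Fˣ) : F) ^ q * (k : Fˣ) * (u : Fˣ)) * hroot v
      + (α ^ q * α' ^ q * ((v : Fˣ) : F) ^ q * (k' : Fˣ) * (u' : Fˣ)) * hroot v'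
  rw [hsub, Ne, mul_eq_zero, or_iff_right hz, sub_eq_zero, not_iff_not, Subtype.ext_iff,
    Units.ext_iff]
  rfl

/-- For `q` even, the number of good sets is `|I|^{q+1} (q+1)! = ((q-2)/2)^{q+1} (q+1)!`. -/
theorem statement16 (q : ℕ) (hq : IsPrimePow q) (hqe : Even q)
    (F : Type) [Field F] [Fintype F] (hF : Fintype.card F = q ^ 2)
    (I : Set F) (hI : IsIndexSet q F I) :
    {G : Finset (F × F × F) | IsGoodSet q F I G}.ncard
        = I.ncard ^ (q + 1) * Nat.factorial (q + 1) ∧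
      I.ncard ^ (q + 1) * Nat.factorial (q + 1)
        = ((q - 2) / 2) ^ (q + 1) * Nat.factorial (q + 1) := by
  have hq2 : 2 ≤ q := hq.two_le
  have hIc := hI.ncard_eq hq2 hqe hF
  refine ⟨?_, by rw [hIc]⟩
  have hU : Nat.card (rootsOfUnity (q + 1) F) = q + 1 := by
    refine natCard_rootsOfUnity_of_dvd ?_
    rw [Nat.card_eq_fintype_card, hF]
    exact ⟨q - 1, by rw [← Nat.sq_sub_sq, one_pow]⟩
  have h0 (α : I) : (α : F) ≠ 0 := fun h => hI.1 (h ▸ α.2)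
  choose κ hκ using fun α : I => exists_mul_pow_eq hF (h0 α)
  let e := Equiv.ofBijective _
    (bijective_div_mul_of_odd_card (by rw [hU]; exact hqe.add_one) κ)
  let j : I × rootsOfUnity (q + 1) F × rootsOfUnity (q + 1) F ↪ F × F × F :=
    ⟨fun t => (t.1, (t.2.1 : Fˣ), (t.2.2 : Fˣ)), by
      rintro ⟨a, u, v⟩ ⟨a', u', v'⟩ h
      simp only [Prod.mk.injEq] at h
      exact Prod.ext (Subtype.ext h.1)
        (Prod.ext (Subtype.ext (Units.ext h.2.1)) (Subtype.ext (Units.ext h.2.2)))⟩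
  have hcond (t t') : ((j t).2.1 * (j t').2.2 - (j t').2.1 * (j t).2.2 ≠ 0 ∧
      (j t).1 * (j t).2.1 * ((j t').1 * (j t').2.2) ^ q
        - ((j t).1 * (j t).2.2) ^ q * ((j t').1 * (j t').2.1) ≠ 0) ↔
      ((e t).2.1 ≠ (e t').2.1 ∧ (e t).2.2 ≠ (e t').2.2) := by
    refine and_congr ?_ (mul_pow_sub_ne_zero_iff (h0 _) (h0 _) (hκ _) (hκ _))
    rw [Ne, Ne, not_iff_not, sub_eq_zero]
    change _ ↔ t.2.1 / t.2.2 = t'.2.1 / t'.2.2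
    rw [div_eq_div_iff_mul_eq_mul, Subtype.ext_iff, Units.ext_iff]
    rfl
  have hjU (t : F × F × F) (ht : t.1 ∈ I ∧ t.2.1 ∈ Uset q F ∧ t.2.2 ∈ Uset q F) :
      t ∈ Set.range j :=
    ⟨(⟨t.1, ht.1⟩, rootsOfUnity.mkOfPowEq _ ht.2.1, rootsOfUnity.mkOfPowEq _ ht.2.2), rfl⟩
  have hjmem (t) : (j t).1 ∈ I ∧ (j t).2.1 ∈ Uset q F ∧ (j t).2.2 ∈ Uset q F :=
    ⟨t.1.2, coe_rootsOfUnity_pow _, coe_rootsOfUnity_pow _⟩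
  have hcount := ncard_labelled_perms e
  rw [← Set.ncard_image_of_injective _ (Finset.map_injective j), hU, Nat.card_coe_set_eq] at hcount
  rw [← hcount]
  congr 1
  ext G
  constructor
  · rintro ⟨hc, hm, hG⟩
    obtain ⟨H, rfl⟩ : ∃ H, Finset.map j H = G := by
      refine ⟨G.preimage j j.injective.injOn, ?_⟩
      classical
      rw [Finset.map_eq_image, Finset.image_preimage_of_bij]
      exact ⟨fun _ h => h, j.injective.injOn, fun t ht => by
        obtain ⟨s, rfl⟩ := hjU t (hm t ht)
        exact ⟨s, ht, rfl⟩⟩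
    refine ⟨H, ⟨by simpa using hc, fun t ht t' ht' hne => (hcond t t').1 ?_⟩, rfl⟩
    exact hG _ (Finset.mem_map_of_mem j ht) _ (Finset.mem_map_of_mem j ht') (j.injective.ne hne)
  · rintro ⟨H, ⟨hc, hH⟩, rfl⟩
    refine ⟨by simpa using hc, ?_, ?_⟩
    · intro t ht
      obtain ⟨s, -, rfl⟩ := Finset.mem_map.1 ht
      exact hjmem s
    · intro t ht t' ht' hne
      obtain ⟨s, hs, rfl⟩ := Finset.mem_map.1 ht
      obtain ⟨s', hs', rfl⟩ := Finset.mem_map.1 ht'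
      exact (hcond s s').2 (hH s hs s' hs' fun h => hne (h ▸ rfl))
end
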